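/- arXiv:1906.02477 — 2 statements merged into one kernel-verified Lean document; each statement's English description precedes it below -/
import Mathlib

section
/- For every k ∈ ℕ and 0 < α < 1, every metric space X that is free of k-point SRA(α)-subspaces satisfies the doubling condition with a constant L = L(k,α) depending only on k and α. -/
open Metric Set

universe u

/-- A subset `S` of a metric space is free of `k`-point `SRA(β)`-subspaces. -/
def SRAFree {X : Type*} [MetricSpace X] (k : ℕ) (β : ℝ) (S : Set X) : Prop :=
  ∀ Y : Finset X, ↑Y ⊆ S → Y.card = k →
    ∃ x ∈ Y, ∃ z ∈ Y, ∃ y ∈ Y,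
      dist x y > max (dist x z + β * dist z y) (β * dist x z + dist z y)

/-- The finite multicolour Ramsey theorem for pairs, with a prescribed size `m i` for each
colour `i`. -/
theorem exists_ramsey_number {ι : Type*} [Fintype ι] [Nonempty ι] (m : ι → ℕ) :
    ∃ N : ℕ, ∀ (V : Type u) (c : V → V → ι), (∀ a b, c a b = c b a) →
      ∀ s : Finset V, N ≤ s.card → ∃ i, ∃ t ⊆ s, t.card = m i ∧
        ∀ a ∈ t, ∀ b ∈ t, a ≠ b → c a b = i := by
  classical
  induction hn : ∑ i, m i using Nat.strong_induction_on generalizing m with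
  | _ n ih =>
    by_cases h0 : ∃ i, m i = 0
    · obtain ⟨i, hi⟩ := h0
      exact ⟨0, fun V c _ s _ => ⟨i, ∅, by simp, by simp [hi], by simp⟩⟩
    push Not at h0
    have hdec (i : ι) : ∑ j, Function.update m i (m i - 1) j < n := by
      rw [← hn]
      refine Finset.sum_lt_sum (fun j _ => ?_) ⟨i, Finset.mem_univ i, ?_⟩
      · by_cases hj : j = i
        · subst hj; simp
        · simp [hj]
      · have := h0 i
        simp only [Function.update_self]
        omega
    choose N hN using fun i => ih _ (hdec i) _ rfl
    refine ⟨∑ i, N i + 1, fun V c hc s hs => ?_⟩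
    obtain ⟨v, hv⟩ : s.Nonempty := Finset.card_pos.mp (by omega)
    obtain ⟨i, -, hi⟩ : ∃ i ∈ Finset.univ, N i ≤ ((s.erase v).filter (c v · = i)).card := by
      refine Finset.exists_le_of_sum_le Finset.univ_nonempty ?_
      rw [← Finset.card_eq_sum_card_fiberwise (f := c v) (fun _ _ => by simp),
        Finset.card_erase_of_mem hv]
      omega
    obtain ⟨j, t, hts, htc, ht⟩ := hN i V c hc _ hi
    have hsub : t ⊆ s := fun a ha =>
      Finset.mem_of_mem_erase (Finset.mem_filter.mp (hts ha)).1
    by_cases hj : j = i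
    · subst hj
      have hvt : v ∉ t := fun h => by simpa using hts h
      have hcol : ∀ a ∈ t, c v a = j := fun a ha => (Finset.mem_filter.mp (hts ha)).2
      refine ⟨j, insert v t, Finset.insert_subset hv hsub, ?_, ?_⟩
      · have := h0 j
        rw [Finset.card_insert_of_notMem hvt, htc, Function.update_self]
        omega
      · intro a ha b hb hab
        rcases Finset.mem_insert.mp ha with rfl | ha'
        · exact hcol b (Finset.mem_of_mem_insert_of_ne hb hab.symm)
        rcases Finset.mem_insert.mp hb with rfl | hb'
        · rw [hc]
          exact hcol a ha'
        · exact ht a ha' b hb' hab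
    · exact ⟨j, t, hsub, by simpa [hj] using htc, ht⟩

/-- Either `n` balls of radius `r` cover `S`, or `S` contains `n` points at mutual distance at
least `r`. -/
theorem exists_cover_or_separated {X : Type*} [MetricSpace X] [Nonempty X] (S : Set X) (r : ℝ)
    (n : ℕ) :
    (∃ c : Fin n → X, S ⊆ ⋃ i, ball (c i) r) ∨
      ∃ p : Fin n → X, (∀ i, p i ∈ S) ∧ ∀ i j, i ≠ j → r ≤ dist (p i) (p j) := by
  induction n with
  | zero => exact Or.inr ⟨Fin.elim0, fun i => i.elim0, fun i => i.elim0⟩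
  | succ n ih =>
    have hpad (c : Fin n → X) (hc : S ⊆ ⋃ i, ball (c i) r) :
        ∃ c : Fin (n + 1) → X, S ⊆ ⋃ i, ball (c i) r := by
      refine ⟨Fin.cons (Classical.arbitrary X) c, fun y hy => ?_⟩
      obtain ⟨i, hi⟩ := mem_iUnion.mp (hc hy)
      exact mem_iUnion.mpr ⟨i.succ, by simpa using hi⟩
    rcases ih with ⟨c, hc⟩ | ⟨p, hpS, hp⟩
    · exact Or.inl (hpad c hc)
    by_cases hcov : S ⊆ ⋃ i, ball (p i) r
    · exact Or.inl (hpad p hcov)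
    obtain ⟨q, hqS, hq⟩ := not_subset.mp hcov
    simp only [mem_iUnion, mem_ball, not_exists, not_lt] at hq
    refine Or.inr ⟨Fin.cons q p, fun i => ?_, fun i j hij => ?_⟩
    · cases i using Fin.cases <;> simp [hqS, hpS]
    · cases i using Fin.cases with
      | zero =>
        cases j using Fin.cases with
        | zero => exact absurd rfl hij
        | succ j => simpa using hq j
      | succ i =>
        cases j using Fin.cases with
        | zero => simpa [dist_comm] using hq i
        | succ j => simpa using hp i j (by simpa using hij)

/-- A set of points whose mutual distances are at least `r`, and differ by at most `α * r`,
satisfies the `SRA(α)` inequality. -/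
theorem dist_le_max_of_almost_equilateral {X : Type*} [MetricSpace X] {α r : ℝ} (hα : 0 ≤ α)
    {Y : Set X} (hsep : ∀ x ∈ Y, ∀ y ∈ Y, x ≠ y → r ≤ dist x y)
    (hclose : ∀ x ∈ Y, ∀ y ∈ Y, ∀ z ∈ Y, x ≠ y → x ≠ z → dist x y ≤ dist x z + α * r)
    {x z y : X} (hx : x ∈ Y) (hz : z ∈ Y) (hy : y ∈ Y) :
    dist x y ≤ max (dist x z + α * dist z y) (α * dist x z + dist z y) := by
  by_cases hxz : x = z
  · subst hxz; simp
  by_cases hzy : z = y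
  · subst hzy; simp
  refine le_max_of_le_left ?_
  by_cases hxy : x = y
  · subst hxy
    rw [dist_self]
    positivity
  · exact (hclose x hx y hy z hz hxy hxz).trans
      (add_le_add_right (mul_le_mul_of_nonneg_left (hsep z hz y hy hzy) hα) _)

theorem stmt_8 (k : ℕ) (α : ℝ) (hα : 0 < α) (hα1 : α < 1) :
    ∃ L : ℕ, ∀ (X : Type u) [MetricSpace X], SRAFree k α (univ : Set X) →
      ∀ (x : X) (R : ℝ), 0 < R →
        ∃ c : Fin L → X, ball x R ⊆ ⋃ i, ball (c i) (R / 2) := by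
  classical
  set M : ℕ := ⌊4 / α⌋₊
  obtain ⟨N, hN⟩ := exists_ramsey_number (ι := Fin (M + 1)) fun _ => k
  refine ⟨N, fun X _ hX x R hR => ?_⟩
  have : Nonempty X := ⟨x⟩
  refine (exists_cover_or_separated (ball x R) (R / 2) N).resolve_right ?_
  rintro ⟨p, hpS, hp⟩
  have hstep : 0 < α * (R / 2) := by positivity
  have hbound (i j : Fin N) : ⌊dist (p i) (p j) / (α * (R / 2))⌋₊ < M + 1 := by
    refine Nat.lt_succ_of_le (Nat.floor_le_floor ?_)
    rw [div_le_div_iff₀ hstep hα]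
    have h₁ := mem_ball.mp (hpS i)
    have h₂ := mem_ball.mp (hpS j)
    have h₃ := dist_triangle_right (p i) (p j) x
    nlinarith
  have hinj : Function.Injective p := fun i j hij => by
    by_contra hne
    have := hp i j hne
    rw [hij, dist_self] at this
    linarith
  obtain ⟨col, t, -, htc, ht⟩ := hN (Fin N) (fun i j => ⟨_, hbound i j⟩)
    (fun i j => by simp [dist_comm]) Finset.univ (by simp)
  obtain ⟨a, ha, b, hb, d, hd, habd⟩ := hX (t.image p) (subset_univ _)
    (by rw [Finset.card_image_of_injective _ hinj, htc])
  refine absurd habd (not_lt.mpr (dist_le_max_of_almost_equilateral (r := R / 2)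
    (Y := ↑(t.image p)) hα.le ?_ ?_ ha hb hd))
  · simp only [Finset.coe_image, mem_image, Finset.mem_coe]
    rintro _ ⟨i, -, rfl⟩ _ ⟨j, -, rfl⟩ hne
    exact hp i j fun h => hne (h ▸ rfl)
  · simp only [Finset.coe_image, mem_image, Finset.mem_coe]
    rintro _ ⟨i, hi, rfl⟩ _ ⟨j, hj, rfl⟩ _ ⟨l, hl, rfl⟩ hij hil
    have hfloor : ⌊dist (p i) (p j) / (α * (R / 2))⌋₊ = ⌊dist (p i) (p l) / (α * (R / 2))⌋₊ :=
      Fin.ext_iff.mp ((ht i hi j hj fun h => hij (h ▸ rfl)).trans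
        (ht i hi l hl fun h => hil (h ▸ rfl)).symm)
    have h₁ := Nat.lt_floor_add_one (dist (p i) (p j) / (α * (R / 2)))
    have h₂ := Nat.floor_le (div_nonneg (dist_nonneg (x := p i) (y := p l)) hstep.le)
    rw [hfloor] at h₁
    have h₃ := h₁.trans_le (add_le_add_left h₂ 1)
    rw [div_add_one hstep.ne', div_lt_div_iff_of_pos_right hstep] at h₃
    exact h₃.le
end

section
/- For every k ∈ ℕ and 0 < α < 1 there exist N ∈ ℕ and D ≥ 1 such that every metric space X which is free of k-point SRA(α)-subspaces admits a bi-Lipschitz embedding Φ : X → ℝᴺ with distortion at most D. -/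
open Metric Set

universe u

/-- The pairs related by `R` are `c`-separated by a family of `N` functions that are `1`-Lipschitz
on the whole space. -/
def Detectable {X : Type*} [MetricSpace X] (N : ℕ) (c : ℝ) (R : X → X → Prop) : Prop :=
  ∃ f : Fin N → X → ℝ, (∀ i, LipschitzWith 1 (f i)) ∧
    ∀ y z, R y z → ∃ i, c * dist y z ≤ |f i y - f i z|

/-- Every subset with pairwise distances in `(a, K * a]` has at most `M` points. -/
def PackingBound (X : Type*) [MetricSpace X] (K : ℝ) (M : ℕ) : Prop :=
  ∀ (T : Finset X) (a : ℝ), 0 < a → (∀ t ∈ T, ∀ t' ∈ T, t ≠ t' → a < dist t t') →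
    (∀ t ∈ T, ∀ t' ∈ T, dist t t' ≤ K * a) → T.card ≤ M

section Combinatorics

/-- Multicolour finite Ramsey theorem for pairs. -/
theorem exists_ramsey_bound (n : ℕ) (f : Fin n → ℕ) :
    ∃ M : ℕ, ∀ {V : Type u} (col : V → V → Fin n), (∀ x y, col x y = col y x) →
      ∀ T : Finset V, M ≤ T.card →
        ∃ i, ∃ Y ⊆ T, Y.card = f i ∧ ∀ x ∈ Y, ∀ y ∈ Y, x ≠ y → col x y = i := by
  classical
  induction hm : ∑ i, f i generalizing f with
  | zero =>
    refine ⟨1, fun {V} col _ T hT => ?_⟩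
    obtain ⟨t, -⟩ := Finset.card_pos.1 hT
    refine ⟨col t t, ∅, by simp, ?_, by simp⟩
    have := (Finset.sum_eq_zero_iff.1 hm) (col t t) (Finset.mem_univ _)
    simp [this]
  | succ m ih =>
    by_cases h0 : ∃ i, f i = 0
    · obtain ⟨i, hi⟩ := h0
      exact ⟨0, fun {V} col _ T _ => ⟨i, ∅, by simp, by simp [hi], by simp⟩⟩
    push Not at h0
    have key : ∀ i, ∃ M : ℕ, ∀ {V : Type u} (col : V → V → Fin n), (∀ x y, col x y = col y x) →
        ∀ T : Finset V, M ≤ T.card → ∃ j, ∃ Y ⊆ T,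
          Y.card = Function.update f i (f i - 1) j ∧
            ∀ x ∈ Y, ∀ y ∈ Y, x ≠ y → col x y = j := by
      intro i
      apply ih
      have h1 := Finset.sum_update_of_mem (Finset.mem_univ i) f (f i - 1)
      have h2 := Finset.add_sum_erase Finset.univ f (Finset.mem_univ i)
      rw [Finset.sdiff_singleton_eq_erase] at h1
      have := h0 i
      omega
    choose M hM using key
    refine ⟨1 + ∑ i, M i, fun {V} col hcol T hT => ?_⟩
    obtain ⟨t, ht⟩ : T.Nonempty := Finset.card_pos.1 (by omega)
    obtain ⟨i, hi⟩ : ∃ i, M i ≤ ((T.erase t).filter (fun s => col t s = i)).card := by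
      by_contra! hlt
      have h1 : (T.erase t).card
          = ∑ i, ((T.erase t).filter (fun s => col t s = i)).card :=
        Finset.card_eq_sum_card_fiberwise (fun _ _ => by simp)
      rw [Finset.card_erase_of_mem ht] at h1
      have h2 : ∑ i, ((T.erase t).filter (fun s => col t s = i)).card < ∑ i, M i :=
        Finset.sum_lt_sum_of_nonempty ⟨col t t, Finset.mem_univ _⟩ fun i _ => hlt i
      omega
    obtain ⟨j, Y, hYT, hYc, hY⟩ := hM i col hcol _ hi
    have hYT' : Y ⊆ T := fun y hy =>
      Finset.mem_of_mem_erase (Finset.mem_filter.1 (hYT hy)).1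
    by_cases hji : j = i
    · subst hji
      have htY : t ∉ Y := fun h => by simpa using (Finset.mem_filter.1 (hYT h)).1
      have hc : ∀ y ∈ Y, col t y = j := fun y hy => (Finset.mem_filter.1 (hYT hy)).2
      refine ⟨j, insert t Y, Finset.insert_subset ht hYT', ?_, ?_⟩
      · rw [Finset.card_insert_of_notMem htY, hYc, Function.update_self]
        have := h0 j
        omega
      · intro x hx y hy hxy
        rcases Finset.mem_insert.1 hx with hx' | hx' <;>
          rcases Finset.mem_insert.1 hy with hy' | hy'
        · exact absurd (hx'.trans hy'.symm) hxy
        · exact hx' ▸ hc y hy'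
        · rw [hcol]; exact hy' ▸ hc x hx'
        · exact hY x hx' y hy' hxy
    · exact ⟨j, Y, hYT', by rw [hYc, Function.update_of_ne hji], hY⟩

/-- Greedy colouring of a finite graph with degrees at most `C`. -/
theorem exists_coloring_of_degree_le {V : Type*} [DecidableEq V] (r : V → V → Prop)
    [DecidableRel r] (hr : ∀ x y, r x y → r y x) (C : ℕ) (Q : Finset V)
    (h : ∀ q ∈ Q, (Q.filter (r q)).card ≤ C) :
    ∃ col : V → Fin (C + 1), ∀ q ∈ Q, ∀ q' ∈ Q, q ≠ q' → r q q' → col q ≠ col q' := by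
  induction Q using Finset.induction_on with
  | empty => exact ⟨fun _ => 0, by simp⟩
  | insert v Q hv ih =>
    obtain ⟨col, hcol⟩ := ih fun q hq => (Finset.card_le_card
      (Finset.filter_subset_filter _ (Finset.subset_insert v Q))).trans
      (h q (Finset.mem_insert_of_mem hq))
    have hcard : ((Q.filter (r v)).image col).card < (Finset.univ : Finset (Fin (C + 1))).card := by
      rw [Finset.card_univ, Fintype.card_fin]
      refine Nat.lt_succ_of_le (Finset.card_image_le.trans ((Finset.card_le_card
        (Finset.filter_subset_filter _ (Finset.subset_insert v Q))).trans
        (h v (Finset.mem_insert_self v Q))))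
    obtain ⟨c, -, hc⟩ := Finset.exists_mem_notMem_of_card_lt_card hcard
    have hc' : ∀ q ∈ Q, r v q → col q ≠ c := fun q hq hvq he =>
      hc (Finset.mem_image.2 ⟨q, Finset.mem_filter.2 ⟨hq, hvq⟩, he⟩)
    have hne : ∀ q ∈ Q, q ≠ v := fun q hq he => hv (he ▸ hq)
    refine ⟨Function.update col v c, fun q hq q' hq' hqq' hrel => ?_⟩
    rcases Finset.mem_insert.1 hq with h₁ | h₁ <;> rcases Finset.mem_insert.1 hq' with h₂ | h₂
    · exact absurd (h₁.trans h₂.symm) hqq'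
    · rw [h₁, Function.update_self, Function.update_of_ne (hne q' h₂)]
      exact (hc' q' h₂ (h₁ ▸ hrel)).symm
    · rw [h₂, Function.update_self, Function.update_of_ne (hne q h₁)]
      exact hc' q h₁ (hr _ _ (h₂ ▸ hrel))
    · rw [Function.update_of_ne (hne q h₁), Function.update_of_ne (hne q' h₂)]
      exact hcol q h₁ q' h₂ hqq' hrel

end Combinatorics

section Lipschitz

variable {X : Type*} [MetricSpace X]

theorem LipschitzWith.abs_sub_le_dist {f : X → ℝ} (hf : LipschitzWith 1 f) (x y : X) :
    |f x - f y| ≤ dist x y := by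
  simpa [Real.dist_eq] using hf.dist_le_mul x y

/-- The upper envelope of a finite family of `1`-Lipschitz functions and `0`. -/
theorem exists_lipschitz_envelope {ι : Type*} (Q : Finset ι) (φ : ι → X → ℝ)
    (hφ : ∀ q, LipschitzWith 1 (φ q)) :
    ∃ F : X → ℝ, LipschitzWith 1 F ∧ (∀ x, 0 ≤ F x) ∧ (∀ q ∈ Q, ∀ x, φ q x ≤ F x) ∧
      ∀ x, F x = 0 ∨ ∃ q ∈ Q, F x = φ q x := by
  classical
  induction Q using Finset.induction_on with
  | empty => exact ⟨fun _ => 0, LipschitzWith.const' 0, by simp, by simp, by simp⟩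
  | insert v Q hv ih =>
    obtain ⟨F, hF, h0, hle, hat⟩ := ih
    refine ⟨fun x => max (φ v x) (F x), by simpa using (hφ v).max hF,
      fun x => le_max_of_le_right (h0 x), fun q hq x => ?_, fun x => ?_⟩
    · rcases Finset.mem_insert.1 hq with rfl | hq
      · exact le_max_left _ _
      · exact le_max_of_le_right (hle q hq x)
    · rcases max_choice (φ v x) (F x) with h | h
      · exact Or.inr ⟨v, Finset.mem_insert_self v Q, h⟩
      · rcases hat x with h' | ⟨q, hq, h'⟩
        · exact Or.inl (h.trans h')
        · exact Or.inr ⟨q, Finset.mem_insert_of_mem hq, h.trans h'⟩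

theorem Detectable.of_fintype {ι : Type*} [Fintype ι] {N : ℕ} {c : ℝ} {R : X → X → Prop}
    (hN : Fintype.card ι ≤ N) (f : ι → X → ℝ) (hf : ∀ i, LipschitzWith 1 (f i))
    (h : ∀ y z, R y z → ∃ i, c * dist y z ≤ |f i y - f i z|) : Detectable N c R := by
  obtain ⟨e⟩ : Nonempty (ι ↪ Fin N) := Function.Embedding.nonempty_of_card_le (by simpa using hN)
  refine ⟨Function.extend e f fun _ _ => 0, fun j => ?_, fun y z hyz => ?_⟩
  · by_cases hj : ∃ i, e i = j
    · obtain ⟨i, rfl⟩ := hj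
      rw [e.injective.extend_apply]
      exact hf i
    · rw [Function.extend_apply' _ _ _ hj]
      exact LipschitzWith.const' 0
  · obtain ⟨i, hi⟩ := h y z hyz
    exact ⟨e i, by rwa [e.injective.extend_apply]⟩

theorem Detectable.mono {N : ℕ} {c : ℝ} {R R' : X → X → Prop} (h : Detectable N c R)
    (hR : ∀ y z, R' y z → R y z) : Detectable N c R' := by
  obtain ⟨f, hf, h⟩ := h
  exact ⟨f, hf, fun y z hyz => h y z (hR y z hyz)⟩

theorem Detectable.or {N₁ N₂ : ℕ} {c₁ c₂ : ℝ} {R₁ R₂ : X → X → Prop}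
    (h₁ : Detectable N₁ c₁ R₁) (h₂ : Detectable N₂ c₂ R₂) :
    Detectable (N₁ + N₂) (min c₁ c₂) fun y z => R₁ y z ∨ R₂ y z := by
  obtain ⟨f, hf, hf'⟩ := h₁
  obtain ⟨g, hg, hg'⟩ := h₂
  refine Detectable.of_fintype (ι := Fin N₁ ⊕ Fin N₂) (by simp) (Sum.elim f g) ?_ ?_
  · rintro (i | i)
    exacts [hf i, hg i]
  · rintro y z (h | h)
    · obtain ⟨i, hi⟩ := hf' y z h
      exact ⟨Sum.inl i, (mul_le_mul_of_nonneg_right (min_le_left _ _) dist_nonneg).trans hi⟩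
    · obtain ⟨i, hi⟩ := hg' y z h
      exact ⟨Sum.inr i, (mul_le_mul_of_nonneg_right (min_le_right _ _) dist_nonneg).trans hi⟩

end Lipschitz

section Packing

variable {X : Type*} [MetricSpace X]

theorem SRAFree.false_of_card_eq {k : ℕ} {α : ℝ} (hα : 0 ≤ α) (hX : SRAFree k α (univ : Set X))
    {Y : Finset X} (hY : Y.card = k)
    (h : ∀ x ∈ Y, ∀ z ∈ Y, ∀ y ∈ Y, x ≠ z → z ≠ y → x ≠ y →
      dist x y ≤ dist x z + α * dist z y ∨ dist x y ≤ α * dist x z + dist z y) : False := by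
  obtain ⟨x, hx, z, hz, y, hy, hlt⟩ := hX Y (subset_univ _) hY
  obtain ⟨h₁, h₂⟩ := max_lt_iff.1 hlt
  have hxz : x ≠ z := by
    rintro rfl
    simp at h₂
  have hzy : z ≠ y := by
    rintro rfl
    simp at h₁
  have hxy : x ≠ y := by
    rintro rfl
    have := mul_nonneg hα (dist_nonneg (x := z) (y := x))
    have := dist_nonneg (x := x) (y := z)
    simp only [dist_self] at h₁
    linarith
  rcases h x hx z hz y hy hxz hzy hxy with h | h <;> linarith

theorem exists_packingBound (k : ℕ) {α : ℝ} (hα : 0 < α) (K : ℝ) :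
    ∃ M : ℕ, ∀ (X : Type u) [MetricSpace X], SRAFree k α (univ : Set X) →
      PackingBound X K M := by
  obtain ⟨M, hM⟩ := exists_ramsey_bound.{u} (⌈K / α⌉₊ + 1) fun _ => k
  refine ⟨M, fun X _ hX T a ha hsep hdiam => ?_⟩
  by_contra! hcard
  obtain ⟨i, Y, hYT, hYk, hY⟩ := hM
    (fun x y : X => (⟨min ⌊(dist x y / a - 1) / α⌋₊ ⌈K / α⌉₊, by omega⟩ : Fin (⌈K / α⌉₊ + 1)))
    (fun x y => by simp only [dist_comm]) T hcard.le
  have hbd : ∀ x ∈ Y, ∀ y ∈ Y, x ≠ y →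
      a * (1 + α * (i : ℕ)) ≤ dist x y ∧ dist x y ≤ a * (1 + α * (i : ℕ)) + α * a := by
    intro x hx y hy hxy
    have hi := congrArg Fin.val (hY x hx y hy hxy)
    have h₁ : 1 ≤ dist x y / a := by
      rw [le_div_iff₀ ha, one_mul]
      exact (hsep x (hYT hx) y (hYT hy) hxy).le
    have h₂ : dist x y / a ≤ K := (div_le_iff₀ ha).2 (hdiam x (hYT hx) y (hYT hy))
    have h₃ : ⌊(dist x y / a - 1) / α⌋₊ ≤ ⌈K / α⌉₊ :=
      (Nat.floor_le_ceil _).trans (Nat.ceil_le_ceil (by gcongr; linarith))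
    simp only [min_eq_left h₃] at hi
    have h₄ := Nat.floor_le (a := (dist x y / a - 1) / α) (by apply div_nonneg <;> linarith)
    have h₅ := Nat.lt_floor_add_one ((dist x y / a - 1) / α)
    rw [hi, le_div_iff₀ hα] at h₄
    rw [hi, div_lt_iff₀ hα] at h₅
    have h₆ : dist x y = a * (dist x y / a) := by field_simp
    constructor <;> rw [h₆] <;> nlinarith
  refine hX.false_of_card_eq hα.le hYk fun x hx z hz y hy hxz hzy hxy => Or.inl ?_
  have h₁ := (hbd x hx y hy hxy).2
  have h₂ := (hbd x hx z hz hxz).1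
  have h₃ := (hsep z (hYT hz) y (hYT hy) hzy).le
  have := mul_le_mul_of_nonneg_left h₃ hα.le
  linarith

end Packing

section Whitney

variable {X : Type*} [MetricSpace X]

/-- A maximal `ρ / 128`-separated subset of the part of `S` where `ρ` is positive. -/
theorem exists_whitney_net (S : Finset X) {ρ : X → ℝ} (hρ : LipschitzWith 1 ρ) :
    ∃ Q ⊆ S, (∀ q ∈ Q, 0 < ρ q) ∧ (∀ q ∈ Q, ∀ q' ∈ Q, q ≠ q' → ρ q / 128 < dist q q') ∧
      ∀ y ∈ S, 0 < ρ y → ∃ q ∈ Q, dist y q ≤ ρ q / 100 := by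
  classical
  let good : Finset X → Prop := fun Q =>
    (∀ q ∈ Q, 0 < ρ q) ∧ ∀ q ∈ Q, ∀ q' ∈ Q, q ≠ q' → ρ q / 128 < dist q q'
  obtain ⟨Q, hQ, hmax⟩ := Finset.exists_max_image (S.powerset.filter good) Finset.card
    ⟨∅, by simp [good]⟩
  simp only [Finset.mem_filter, Finset.mem_powerset] at hQ hmax
  obtain ⟨hQS, hpos, hsep⟩ := hQ
  refine ⟨Q, hQS, hpos, hsep, fun y hy hy0 => ?_⟩
  by_contra! hfar
  have hyQ : y ∉ Q := fun h => by
    have := hfar y h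
    rw [dist_self] at this
    linarith
  have hcl : ∀ q ∈ Q, ρ q / 128 < dist q y ∧ ρ y / 128 < dist q y := fun q hq => by
    have h₁ := hfar q hq
    have h₂ := (abs_le.1 (hρ.abs_sub_le_dist y q)).2
    have h₃ := hpos q hq
    rw [dist_comm q y]
    constructor <;> linarith
  have := hmax (insert y Q) ⟨Finset.insert_subset hy hQS, fun q hq => ?_, fun q hq q' hq' hne => ?_⟩
  · rw [Finset.card_insert_of_notMem hyQ] at this
    omega
  · rcases Finset.mem_insert.1 hq with h | h
    exacts [h ▸ hy0, hpos q h]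
  · rcases Finset.mem_insert.1 hq with h | h <;> rcases Finset.mem_insert.1 hq' with h' | h'
    · exact absurd (h.trans h'.symm) hne
    · rw [h, dist_comm]
      exact (hcl q' h').2
    · rw [h']
      exact (hcl q h).1
    · exact hsep q h q' h' hne

/-- Functions separating pairs inside each ball of radius `ρ q` can be glued into functions
separating all pairs at distance at most `A * ρ`. -/
theorem Detectable.of_local {N C : ℕ} {c A : ℝ} (hA : 1 ≤ A)
    (hC : PackingBound X (256 * ((2 + 4 * A) * (3 + 4 * A))) C)
    {ρ : X → ℝ} (hρ : LipschitzWith 1 ρ) (S : Finset X) {R : X → X → Prop}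
    (hRS : ∀ y z, R y z → y ∈ S)
    (hloc : ∀ q, 0 < ρ q → Detectable N c fun y z => R y z ∧ dist y q ≤ ρ q ∧ dist z q ≤ ρ q) :
    Detectable ((C + 1) * (N + 1)) (min c (1 / (50 * A)))
      fun y z => R y z ∧ dist y z ≤ A * ρ y := by
  classical
  obtain ⟨Q, -, hpos, hsep, hnet⟩ := exists_whitney_net S hρ
  have hlip : ∀ x y, ρ x ≤ ρ y + dist x y := fun x y => by
    have := (abs_le.1 (hρ.abs_sub_le_dist x y)).2
    linarith
  have hB : 0 < 3 + 4 * A := by linarith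
  -- colour the net so that nearby points of comparable radius get different colours
  obtain ⟨col, hcol⟩ := exists_coloring_of_degree_le
    (fun q q' => q ≠ q' ∧ dist q q' ≤ (2 + 4 * A) * ρ q ∧ dist q q' ≤ (2 + 4 * A) * ρ q')
    (fun q q' h => ⟨h.1.symm, dist_comm q q' ▸ h.2.2, dist_comm q q' ▸ h.2.1⟩) C Q (by
      intro q hq
      have hq0 := hpos q hq
      refine hC _ (ρ q / (128 * (3 + 4 * A))) (by positivity) ?_ ?_
      · intro t ht t' ht' hne
        obtain ⟨htQ, -, -, ht⟩ := Finset.mem_filter.1 ht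
        refine lt_of_le_of_lt ?_ (hsep t htQ t' (Finset.mem_filter.1 ht').1 hne)
        rw [div_le_div_iff₀ (by positivity) (by norm_num)]
        have := hlip q t
        nlinarith
      · intro t ht t' ht'
        have h₁ := (Finset.mem_filter.1 ht).2.2.1
        have h₂ := (Finset.mem_filter.1 ht').2.2.1
        have h₃ := dist_triangle_left t t' q
        have h₄ : 256 * ((2 + 4 * A) * (3 + 4 * A)) * (ρ q / (128 * (3 + 4 * A)))
            = 2 * ((2 + 4 * A) * ρ q) := by
          field_simp
          ring
        linarith)
  have hcol' : ∀ q ∈ Q, ∀ q' ∈ Q, col q = col q' → dist q q' ≤ (1 + 2 * A) * ρ q →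
      ρ q ≤ 2 * ρ q' → q = q' := by
    intro q hq q' hq' he hd hr
    by_contra hne
    have := hpos q hq
    refine hcol q hq q' hq' hne ⟨hne, ?_, ?_⟩ he <;> nlinarith
  have hf : ∀ q, ∃ f : Fin N → X → ℝ, (∀ i, LipschitzWith 1 (f i)) ∧ (0 < ρ q → ∀ y z,
      R y z ∧ dist y q ≤ ρ q ∧ dist z q ≤ ρ q → ∃ i, c * dist y z ≤ |f i y - f i z|) := by
    intro q
    by_cases hq : 0 < ρ q
    · obtain ⟨f, hf, hf'⟩ := hloc q hq
      exact ⟨f, hf, fun _ => hf'⟩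
    · exact ⟨fun _ _ => 0, fun _ => LipschitzWith.const' 0, fun h => absurd h hq⟩
  choose f hf hdet using hf
  have htent : ∀ q, LipschitzWith 1 fun x => ρ q / 4 - dist x q := fun q =>
    LipschitzWith.of_le_add fun x y => by
      have := dist_triangle_left y q x
      linarith
  have hbump : ∀ i q, LipschitzWith 1 fun x =>
      min (max 0 (f q i x - f q i q + ρ q / 16)) (max 0 (ρ q / 4 - dist x q)) := by
    intro i q
    have h : LipschitzWith 1 fun x => f q i x - f q i q + ρ q / 16 :=
      LipschitzWith.of_le_add fun x y => by
        have := (abs_le.1 ((hf q i).abs_sub_le_dist x y)).2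
        linarith
    simpa using (h.const_max 0).min ((htent q).const_max 0)
  have hT := fun a : Fin (C + 1) => exists_lipschitz_envelope (Q.filter fun q => col q = a)
    (fun q x => ρ q / 4 - dist x q) htent
  choose T hTlip hT0 hTle hTat using hT
  have hF := fun (a : Fin (C + 1)) (i : Fin N) =>
    exists_lipschitz_envelope (Q.filter fun q => col q = a) _ (hbump i)
  choose F hFlip hF0 hFle hFat using hF
  refine Detectable.of_fintype (ι := Fin (C + 1) × Option (Fin N)) (by simp)
    (fun j => j.2.elim (T j.1) (F j.1)) ?_ ?_
  · rintro ⟨a, _ | i⟩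
    exacts [hTlip a, hFlip a i]
  rintro y z ⟨hyz, hd⟩
  have hc₁ : min c (1 / (50 * A)) * dist y z ≤ c * dist y z :=
    mul_le_mul_of_nonneg_right (min_le_left _ _) dist_nonneg
  have hc₂ : min c (1 / (50 * A)) * dist y z ≤ 1 / (50 * A) * dist y z :=
    mul_le_mul_of_nonneg_right (min_le_right _ _) dist_nonneg
  rcases le_or_gt (ρ y) 0 with hy0 | hy0
  · have : dist y z = 0 := le_antisymm (hd.trans (by nlinarith)) dist_nonneg
    exact ⟨⟨0, none⟩, by simp [this]⟩
  obtain ⟨q, hq, hyq⟩ := hnet y (hRS y z hyz) hy0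
  have hq0 := hpos q hq
  have hzq := dist_triangle_left z q y
  have hqz := dist_triangle_right y z q
  rcases le_or_gt (dist y z) (ρ q / 20) with hnear | hmid
  · obtain ⟨i, hi⟩ := hdet q hq0 y z ⟨hyz, by linarith, by linarith⟩
    refine ⟨⟨col q, some i⟩, ?_⟩
    have hval : ∀ x, dist x q ≤ ρ q / 16 →
        F (col q) i x = f q i x - f q i q + ρ q / 16 := by
      intro x hx
      have h₁ := abs_le.1 ((hf q i).abs_sub_le_dist x q)
      have hown : min (max 0 (f q i x - f q i q + ρ q / 16)) (max 0 (ρ q / 4 - dist x q))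
          = f q i x - f q i q + ρ q / 16 := by
        rw [max_eq_right (by linarith), max_eq_right (by linarith), min_eq_left (by linarith)]
      have hge := hFle (col q) i q (Finset.mem_filter.2 ⟨hq, rfl⟩) x
      rw [hown] at hge
      refine le_antisymm ?_ hge
      rcases hFat (col q) i x with h | ⟨q', hq', h⟩
      · linarith
      obtain ⟨hq'Q, hq'c⟩ := Finset.mem_filter.1 hq'
      by_cases hqq' : q' = q
      · rw [h, hqq', hown]
      · have hfar : ρ q' / 4 ≤ dist x q' := by
          by_contra! hlt
          have h₂ := dist_triangle_left q q' x
          have h₃ := hlip q' q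
          have h₄ := hlip q q'
          rw [dist_comm q' q] at h₃
          exact hqq' (hcol' q hq q' hq'Q hq'c.symm (by nlinarith) (by linarith)).symm
        rw [h]
        refine (min_le_right _ _).trans ?_
        rw [max_eq_left (by linarith)]
        linarith
    have hy' := hval y (by linarith)
    have hz' := hval z (by linarith)
    simp only [Option.elim_some, hy', hz']
    refine hc₁.trans (hi.trans_eq ?_)
    congr 1
    ring
  · refine ⟨⟨col q, none⟩, ?_⟩
    have hylow := hTle (col q) q (Finset.mem_filter.2 ⟨hq, rfl⟩) y
    have hzup : T (col q) z ≤ ρ q * (21 / 100) := by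
      rcases hTat (col q) z with h | ⟨q', hq', h⟩
      · rw [h]; positivity
      obtain ⟨hq'Q, hq'c⟩ := Finset.mem_filter.1 hq'
      by_cases hqq' : q' = q
      · rw [h, hqq']
        linarith
      · by_contra! hlt
        have h₁ := dist_nonneg (x := z) (y := q')
        have h₂ := dist_triangle q z q'
        have h₃ := hlip q' q
        have h₄ := hlip y q
        rw [dist_comm q' q] at h₃
        rw [dist_comm q z] at h₂
        have h₅ : A * ρ y ≤ A * (ρ q * (101 / 100)) :=
          mul_le_mul_of_nonneg_left (by linarith) (by linarith)
        exact hqq' (hcol' q hq q' hq'Q hq'c.symm (by nlinarith) (by linarith)).symm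
    have h₄ := hlip y q
    have hd' : 1 / (50 * A) * dist y z ≤ ρ q * (3 / 100) := by
      rw [one_div, inv_mul_le_iff₀ (by positivity)]
      nlinarith
    simp only [Option.elim_none]
    refine hc₂.trans (le_trans ?_ (le_abs_self _))
    linarith

end Whitney

section FarChain

variable {X : Type*} [MetricSpace X]

/-- Seen from each point of `P`, the set `S` is small, and the points of `P` lie at separated
scales from `S` such that each of them together with `S` is almost equidistant from the
farther ones. -/
structure IsFarChain (ε : ℝ) (P S : Finset X) : Prop where
  pos : ∀ p ∈ P, ∀ x ∈ S, 0 < dist p x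
  far : ∀ p ∈ P, ∀ x ∈ S, ∀ x' ∈ S, dist x x' ≤ dist p x / 2
  flat : ∀ x ∈ S, ∀ p ∈ P, ∀ p' ∈ P, p ≠ p' →
    (dist p' x ≤ dist p x / 2 ∧ |dist p p' - dist p x| ≤ ε * dist p' x) ∨
    (dist p x ≤ dist p' x / 2 ∧ |dist p p' - dist p' x| ≤ ε * dist p x)

theorem IsFarChain.false_of_card_eq {k : ℕ} {α : ℝ} (hα : 0 < α) (hα1 : α < 1)
    (hX : SRAFree k α (univ : Set X)) {P S : Finset X} (h : IsFarChain (α / 4) P S)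
    (hP : P.card = k) {x : X} (hx : x ∈ S) : False := by
  refine hX.false_of_card_eq hα.le hP fun a ha c hc b hb hac hcb hab => ?_
  have ha0 := h.pos a ha x hx
  have hb0 := h.pos b hb x hx
  have hc0 := h.pos c hc x hx
  have key : ∀ {u v w U V W : ℝ}, 0 < W → W ≤ V / 2 → V ≤ U / 2 →
      |u - U| ≤ α / 4 * V → |v - U| ≤ α / 4 * W → |w - V| ≤ α / 4 * W →
      u ≤ v + α * w ∧ v ≤ u + α * w ∧ w ≤ u ∧ w ≤ v ∧ 0 < u ∧ 0 < v ∧ 0 < w := by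
    intro u v w U V W hW hWV hVU h₁ h₂ h₃
    rw [abs_le] at h₁ h₂ h₃
    have e₁ : α / 4 * V ≤ V / 4 := by nlinarith
    have e₂ : α / 4 * W ≤ W / 4 := by nlinarith
    have e₃ : α * W ≤ α * V / 2 := by nlinarith
    have e₄ : α * (V * (7 / 8)) ≤ α * w := mul_le_mul_of_nonneg_left (by linarith) hα.le
    have e₅ : 0 < α * V := by nlinarith
    refine ⟨?_, ?_, ?_, ?_, ?_, ?_, ?_⟩ <;> linarith
  have hm : ∀ {r : ℝ}, 0 < r → 0 < α * r := fun hr => mul_pos hα hr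
  rcases h.flat x hx a ha b hb hab with ⟨h₁, h₁'⟩ | ⟨h₁, h₁'⟩ <;>
  rcases h.flat x hx a ha c hc hac with ⟨h₂, h₂'⟩ | ⟨h₂, h₂'⟩ <;>
  rcases h.flat x hx c hc b hb hcb with ⟨h₃, h₃'⟩ | ⟨h₃, h₃'⟩
  · obtain ⟨e₁, e₂, e₃, e₄, e₅, e₆, e₇⟩ := key hb0 h₃ h₂ h₂' h₁' h₃'
    exact Or.inl e₂
  · obtain ⟨e₁, e₂, e₃, e₄, e₅, e₆, e₇⟩ := key hc0 h₃ h₁ h₁' h₂' h₃'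
    exact Or.inl e₁
  · obtain ⟨e₁, e₂, e₃, e₄, e₅, e₆, e₇⟩ := key hb0 h₁ h₂ h₂' h₃' h₁'
    have := hm e₅
    exact Or.inr (by linarith)
  · linarith
  · linarith
  · obtain ⟨e₁, e₂, e₃, e₄, e₅, e₆, e₇⟩ := key hc0 h₂ h₁ h₁' h₃' h₂'
    exact Or.inr (by linarith)
  · obtain ⟨e₁, e₂, e₃, e₄, e₅, e₆, e₇⟩ := key ha0 h₁ h₃ h₃' h₂' h₁'
    have := hm e₅
    exact Or.inl (by linarith)
  · obtain ⟨e₁, e₂, e₃, e₄, e₅, e₆, e₇⟩ := key ha0 h₂ h₃ h₃' h₁' h₂'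
    exact Or.inr (by linarith)

/-- A pair almost equidistant from all points of a far chain extends the chain by one point. -/
theorem IsFarChain.insert [DecidableEq X] {α : ℝ} (hα : 0 < α) (hα1 : α < 1) {P S : Finset X}
    (h : IsFarChain (α / 4) P S) {a b : X} (hb : b ∈ S) (hab : a ≠ b)
    (hflat : ∀ p ∈ P, |dist p a - dist p b| ≤ α / 16 * dist a b) :
    IsFarChain (α / 4) (insert b P) (S.filter fun x => dist x a ≤ α / 16 * dist a b) := by
  have hr : 0 < dist a b := dist_pos.2 hab
  have hrα : α / 16 * dist a b ≤ dist a b / 16 := by nlinarith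
  have hbx : ∀ x, dist x a ≤ α / 16 * dist a b → dist a b * (15 / 16) ≤ dist b x := by
    intro x hx
    have := dist_triangle_left a b x
    rw [dist_comm x b] at this
    linarith
  have hpb : ∀ p ∈ P, ∀ x ∈ S, dist x a ≤ α / 16 * dist a b →
      dist b x ≤ dist p x / 2 ∧ |dist p b - dist p x| ≤ α / 4 * dist b x := by
    intro p hp x hx hxa
    refine ⟨dist_comm x b ▸ h.far p hp x hx b hb, ?_⟩
    have h₁ := abs_le.1 (hflat p hp)
    have h₂ := dist_triangle p x a
    have h₃ := dist_triangle_right p x a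
    have h₄ := mul_le_mul_of_nonneg_left (hbx x hxa) hα.le
    have h₅ := mul_pos hα hr
    rw [abs_le]
    constructor <;> linarith
  constructor
  · intro p hp x hx
    obtain ⟨hxS, hxa⟩ := Finset.mem_filter.1 hx
    rcases Finset.mem_insert.1 hp with rfl | hp
    · linarith [hbx x hxa]
    · exact h.pos p hp x hxS
  · intro p hp x hx x' hx'
    obtain ⟨hxS, hxa⟩ := Finset.mem_filter.1 hx
    obtain ⟨hxS', hxa'⟩ := Finset.mem_filter.1 hx'
    rcases Finset.mem_insert.1 hp with rfl | hp
    · have := dist_triangle_right x x' a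
      linarith [hbx x hxa]
    · exact h.far p hp x hxS x' hxS'
  · intro x hx p hp p' hp' hne
    obtain ⟨hxS, hxa⟩ := Finset.mem_filter.1 hx
    rcases Finset.mem_insert.1 hp with hp | hp <;> rcases Finset.mem_insert.1 hp' with hp' | hp'
    · exact absurd (hp.trans hp'.symm) hne
    · rw [hp, dist_comm b p']
      exact Or.inr (hpb p' hp' x hxS hxa)
    · rw [hp']
      exact Or.inl (hpb p hp x hxS hxa)
    · exact h.flat x hxS p hp p' hp' hne

theorem exists_detectable_of_isFarChain (k : ℕ) {α : ℝ} (hα : 0 < α) (hα1 : α < 1) (m : ℕ) :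
    ∃ (N : ℕ) (c : ℝ), 0 < c ∧ ∀ (X : Type u) [MetricSpace X], SRAFree k α (univ : Set X) →
      ∀ P S : Finset X, P.card + m = k → IsFarChain (α / 4) P S →
        Detectable N c fun y z => y ∈ S ∧ z ∈ S := by
  classical
  induction m with
  | zero =>
    exact ⟨0, 1, one_pos, fun X _ hX P S hP h => ⟨fun _ _ => 0, fun _ => LipschitzWith.const' 0,
      fun y z hyz => (h.false_of_card_eq hα hα1 hX hP hyz.1).elim⟩⟩
  | succ m ih =>
    obtain ⟨N, c, hc, ih⟩ := ih
    have hA : 1 ≤ 16 / α := by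
      rw [le_div_iff₀ hα]
      linarith
    obtain ⟨C, hC⟩ := exists_packingBound.{u} k hα
      (256 * ((2 + 4 * (16 / α)) * (3 + 4 * (16 / α))))
    refine ⟨k + (C + 1) * (N + 1), min (α / 16) (min c (1 / (50 * (16 / α)))), by positivity,
      fun X _ hX P S hP h => ?_⟩
    obtain ⟨ρ, hρ, hρ0, hρle, hρat⟩ := exists_lipschitz_envelope
      ((S ×ˢ S).filter fun w => ∀ p ∈ P,
        |dist p w.1 - dist p w.2| ≤ α / 16 * dist w.1 w.2)
      (fun w x => α / 16 * dist w.1 w.2 - dist x w.1)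
      (fun w => LipschitzWith.of_le_add fun x y => by
        have := dist_triangle_left y w.1 x
        linarith)
    have hdet : Detectable k (α / 16) fun y z => ∃ p ∈ P,
        α / 16 * dist y z ≤ |dist p y - dist p z| :=
      Detectable.of_fintype (ι := P) (by rw [Fintype.card_coe]; omega) (fun p => dist p.1)
        (fun p => LipschitzWith.dist_right _) fun y z ⟨p, hp, hyz⟩ => ⟨⟨p, hp⟩, hyz⟩
    have hglue := Detectable.of_local (N := N) (c := c) hA (hC X hX) hρ S
      (R := fun y z => y ∈ S ∧ z ∈ S) (fun y z hyz => hyz.1) (by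
        intro q hq
        rcases hρat q with h0 | ⟨⟨a, b⟩, hab, hval⟩
        · exact absurd h0 hq.ne'
        obtain ⟨habS, hflat⟩ := Finset.mem_filter.1 hab
        have hb := (Finset.mem_product.1 habS).2
        simp only at hb hflat hval
        have hne : a ≠ b := by
          rintro rfl
          have := dist_nonneg (x := q) (y := a)
          rw [dist_self] at hval
          linarith
        have hbP : b ∉ P := fun hbP => by simpa using h.pos b hbP b hb
        refine (ih X hX (insert b P) _ ?_ (h.insert hα hα1 hb hne hflat)).mono ?_
        · rw [Finset.card_insert_of_notMem hbP]
          omega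
        · rintro y z ⟨⟨hy, hz⟩, hyq, hzq⟩
          have h₁ := dist_triangle y q a
          have h₂ := dist_triangle z q a
          exact ⟨Finset.mem_filter.2 ⟨hy, by linarith⟩, Finset.mem_filter.2 ⟨hz, by linarith⟩⟩)
    refine (hdet.or hglue).mono fun y z hyz => ?_
    by_cases hflat : ∀ p ∈ P, |dist p y - dist p z| ≤ α / 16 * dist y z
    · refine Or.inr ⟨hyz, ?_⟩
      have := hρle (y, z) (Finset.mem_filter.2 ⟨Finset.mem_product.2 hyz, hflat⟩) y
      simp only [dist_self, sub_zero] at this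
      rw [div_mul_eq_mul_div, le_div_iff₀ hα]
      linarith
    · push Not at hflat
      obtain ⟨p, hp, hlt⟩ := hflat
      exact Or.inl ⟨p, hp, hlt.le⟩

end FarChain

/-- Bi-Lipschitz embeddings of finite subsets with uniform constants yield an embedding of the
whole space. -/
theorem exists_biLipschitz_of_finset {X E : Type*} [MetricSpace X] [NormedAddCommGroup E]
    [ProperSpace E] {a b : ℝ}
    (h : ∀ S : Finset X, ∃ Φ : X → E, (∀ x ∈ S, ∀ y ∈ S, a * dist x y ≤ dist (Φ x) (Φ y)) ∧
      ∀ x y, dist (Φ x) (Φ y) ≤ b * dist x y) :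
    ∃ Φ : X → E, ∀ x y, a * dist x y ≤ dist (Φ x) (Φ y) ∧ dist (Φ x) (Φ y) ≤ b * dist x y := by
  classical
  rcases isEmpty_or_nonempty X with hX | ⟨⟨o⟩⟩
  · exact ⟨fun _ => 0, fun x => isEmptyElim x⟩
  choose Ψ hΨ hΨ' using h
  let U : Ultrafilter (Finset X) := Ultrafilter.of Filter.atTop
  have hU : (U : Filter (Finset X)) ≤ Filter.atTop := Ultrafilter.of_le _
  have hlim : ∀ x, ∃ v : E, Filter.Tendsto (fun S => Ψ S x - Ψ S o) U (nhds v) := by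
    intro x
    obtain ⟨v, -, hv⟩ := (isCompact_closedBall (0 : E) (b * dist x o)).ultrafilter_le_nhds
      (U.map fun S => Ψ S x - Ψ S o) (by
        rw [Filter.le_principal_iff]
        refine Filter.Eventually.of_forall (f := (U : Filter (Finset X))) fun S => ?_
        rw [mem_closedBall_zero_iff, ← dist_eq_norm]
        exact hΨ' S x o)
    exact ⟨v, hv⟩
  choose Φ hΦ using hlim
  refine ⟨Φ, fun x y => ?_⟩
  have hd := (hΦ x).dist (hΦ y)
  simp only [dist_sub_right] at hd
  refine ⟨ge_of_tendsto hd ?_, le_of_tendsto hd (Filter.Eventually.of_forall fun S => hΨ' S x y)⟩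
  filter_upwards [hU (Filter.mem_atTop ({x, y} : Finset X))] with S hS
  exact hΨ S x (hS (by simp)) y (hS (by simp))

theorem Detectable.exists_map {X : Type*} [MetricSpace X] {N : ℕ} {c : ℝ} {S : Finset X}
    (h : Detectable N c fun y z => y ∈ S ∧ z ∈ S) :
    ∃ Φ : X → EuclideanSpace ℝ (Fin N),
      (∀ x ∈ S, ∀ y ∈ S, c * dist x y ≤ dist (Φ x) (Φ y)) ∧
        ∀ x y, dist (Φ x) (Φ y) ≤ √N * dist x y := by
  obtain ⟨f, hf, hdet⟩ := h
  refine ⟨fun x => WithLp.toLp 2 fun i => f i x, fun x hx y hy => ?_, fun x y => ?_⟩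
  · obtain ⟨i, hi⟩ := hdet x y ⟨hx, hy⟩
    rw [EuclideanSpace.dist_eq]
    refine hi.trans (Real.le_sqrt_of_sq_le ?_)
    exact Finset.single_le_sum (f := fun i => dist (f i x) (f i y) ^ 2)
      (fun _ _ => sq_nonneg _) (Finset.mem_univ i)
  · rw [EuclideanSpace.dist_eq]
    refine Real.sqrt_le_iff.2 ⟨by positivity, ?_⟩
    rw [mul_pow, Real.sq_sqrt (Nat.cast_nonneg N)]
    refine (Finset.sum_le_card_nsmul _ _ (dist x y ^ 2) fun i _ => ?_).trans_eq (by simp)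
    exact pow_le_pow_left₀ dist_nonneg ((hf i).abs_sub_le_dist x y) 2

theorem stmt_14 (k : ℕ) (α : ℝ) (hα : 0 < α) (hα1 : α < 1) :
    ∃ (N : ℕ) (D : ℝ), 1 ≤ D ∧
      ∀ (X : Type u) [MetricSpace X], SRAFree k α (univ : Set X) →
        ∃ (Φ : X → EuclideanSpace ℝ (Fin N)) (s : ℝ), 0 < s ∧
          ∀ x₁ x₂ : X, s * dist x₁ x₂ ≤ dist (Φ x₁) (Φ x₂) ∧
            dist (Φ x₁) (Φ x₂) ≤ D * s * dist x₁ x₂ := by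
  obtain ⟨N, c, hc, h⟩ := exists_detectable_of_isFarChain.{u} k hα hα1 k
  refine ⟨N, max 1 (√N / c), le_max_left _ _, fun X _ hX => ?_⟩
  obtain ⟨Φ, hΦ⟩ := exists_biLipschitz_of_finset fun S : Finset X =>
    (h X hX ∅ S (by simp) ⟨by simp, by simp, by simp⟩).exists_map
  refine ⟨Φ, c, hc, fun x y => ⟨(hΦ x y).1, (hΦ x y).2.trans ?_⟩⟩
  refine mul_le_mul_of_nonneg_right ?_ dist_nonneg
  rw [← div_le_iff₀ hc]
  exact le_max_right _ _
end
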